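/- arXiv:1012.0608 — 6 statements merged into one kernel-verified Lean document; each statement's English description precedes it below -/
import Mathlib

section
/- Let L be a finite-dimensional left Leibniz algebra over a field K. If for every a ∈ L the left multiplication operator d_a : L → L, d_a(x) = a·x, is nilpotent, then L is nilpotent; that is, there exists a positive integer n such that every left-normed iterated product a₁·(a₂·(⋯·(a_{n-1}·a_n)⋯)) of n elements a₁, …, a_n ∈ L is zero. -/
/-- Engel's theorem for Leibniz algebras (Ayupov–Omirov): if every left
multiplication operator of a finite-dimensional left Leibniz algebra is
nilpotent, then the algebra is nilpotent, i.e. there is a positive `n` such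
that every left-normed product of `n` elements vanishes. -/
theorem engel_leibniz
    (K : Type*) [Field K] (L : Type*) [AddCommGroup L] [Module K L]
    [FiniteDimensional K L]
    (mul : L →ₗ[K] L →ₗ[K] L)
    (leib : ∀ a b c : L, mul a (mul b c) = mul (mul a b) c + mul b (mul a c))
    (hnil : ∀ a : L, IsNilpotent (mul a : Module.End K L)) :
    ∃ n : ℕ, 0 < n ∧ ∀ (a : L) (l : List L),
      l.length + 1 = n → l.foldr (fun x y => mul x y) a = 0 := by
  letI : LieRing (Module.End K L) := LieRing.ofAssociativeRing
  let S : LieSubalgebra K (Module.End K L) :=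
    { LinearMap.range mul with
      lie_mem' := by
        rintro _ _ ⟨a, rfl⟩ ⟨b, rfl⟩
        refine ⟨mul a b, ?_⟩
        ext c
        simp [Ring.lie_def, leib a b c] }
  have hS : LieModule.IsNilpotent S L := by
    rw [LieModule.isNilpotent_iff_forall' (R := K)]
    rintro ⟨_, a, rfl⟩
    exact hnil a
  obtain ⟨k, hk⟩ := (LieModule.isNilpotent_iff K S L).1 hS
  refine ⟨k + 1, Nat.succ_pos k, fun a l hl => ?_⟩
  have key : ∀ l : List L, l.foldr (fun x y => mul x y) a ∈
      LieModule.lowerCentralSeries K S L l.length := by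
    intro l
    induction l with
    | nil => simp
    | cons x l ih =>
      rw [List.length_cons, LieModule.lowerCentralSeries_succ]
      exact LieSubmodule.lie_mem_lie (x := (⟨mul x, x, rfl⟩ : S)) (LieSubmodule.mem_top _) ih
  have h := key l
  rw [Nat.succ.inj hl, hk] at h
  simpa using h
end

section
/- Let L be a finite-dimensional left Leibniz algebra over a field K and let V be a finite-dimensional L-bimodule. If the left action operator T_a : V → V, T_a(v) = a·v, is nilpotent for every a ∈ L, then the right action operator S_a : V → V, S_a(v) = v·a, is nilpotent for every a ∈ L. -/
/-- If the left action of every element of a finite-dimensional left Leibniz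
algebra on a finite-dimensional bimodule is nilpotent, then so is the right
action of every element. -/
theorem right_action_nilpotent
    (K : Type*) [Field K]
    (L : Type*) [AddCommGroup L] [Module K L] [FiniteDimensional K L]
    (V : Type*) [AddCommGroup V] [Module K V] [FiniteDimensional K V]
    (mul : L →ₗ[K] L →ₗ[K] L)
    (leib : ∀ a b c : L, mul a (mul b c) = mul (mul a b) c + mul b (mul a c))
    (T S : L →ₗ[K] V →ₗ[K] V)
    (M1 : ∀ (a b : L) (v : V), T a (T b v) = T (mul a b) v + T b (T a v))
    (M2 : ∀ (a b : L) (v : V), T a (S b v) = S b (T a v) + S (mul a b) v)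
    (M3 : ∀ (a b : L) (v : V), S (mul a b) v = S b (S a v) + T a (S b v))
    (hT : ∀ a : L, IsNilpotent (T a : Module.End K V)) :
    ∀ a : L, IsNilpotent (S a : Module.End K V) := by
  intro a
  have h2 : (S a : Module.End K V) * S a = S a * (-(T a : Module.End K V)) := by
    ext v
    have h := M2 a a v
    rw [M3 a a v] at h
    simp only [Module.End.mul_apply, LinearMap.neg_apply, map_neg]
    have h' : T a (S a v) = T a (S a v) + (S a (T a v) + S a (S a v)) := by
      exact h.trans (by abel)
    have h3 := left_eq_add.mp h'
    exact eq_neg_of_add_eq_zero_right h3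
  have key : ∀ n : ℕ, (S a : Module.End K V) ^ (n + 1)
      = S a * (-(T a : Module.End K V)) ^ n := by
    intro n
    induction n with
    | zero => simp
    | succ n ih => rw [pow_succ' _ (n + 1), ih, ← mul_assoc, h2, mul_assoc, ← pow_succ']
  obtain ⟨n, hn⟩ := (hT a).neg
  exact ⟨n + 1, by rw [key, hn, mul_zero]⟩
end

section
/- Let L be a finite-dimensional left Leibniz algebra over a field K and let V be a finite-dimensional L-bimodule with V ≠ 0. If the left action operator T_a : V → V, T_a(v) = a·v, is nilpotent for every a ∈ L, then there exists v ∈ V with v ≠ 0 such that a·v = 0 and v·a = 0 for all a ∈ L. -/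
attribute [local instance] LieRing.ofAssociativeRing

/-- Engel theorem for a linear family of nilpotent operators closed under commutators. -/
theorem engel_aux
    (K : Type*) [Field K]
    (L : Type*) [AddCommGroup L] [Module K L]
    (V : Type*) [AddCommGroup V] [Module K V] [FiniteDimensional K V] [Nontrivial V]
    (mul : L →ₗ[K] L →ₗ[K] L)
    (T : L →ₗ[K] Module.End K V)
    (M1 : ∀ (a b : L) (v : V), T a (T b v) = T (mul a b) v + T b (T a v))
    (hT : ∀ a : L, IsNilpotent (T a)) :
    ∃ v : V, v ≠ 0 ∧ ∀ a : L, T a v = 0 := by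
  let A : LieSubalgebra K (Module.End K V) :=
    { LinearMap.range T with
      lie_mem' := by
        rintro _ _ ⟨a, rfl⟩ ⟨b, rfl⟩
        refine ⟨mul a b, ?_⟩
        ext v
        simp [Ring.lie_def, M1 a b v] }
  have hA : LieModule.IsNilpotent A V := by
    rw [LieModule.isNilpotent_iff_forall' (R := K)]
    rintro ⟨_, ⟨a, rfl⟩⟩
    exact hT a
  have hn := LieModule.nontrivial_max_triv_of_isNilpotent K A V
  obtain ⟨⟨v, hv⟩, hne⟩ := exists_ne (0 : LieModule.maxTrivSubmodule K A V)
  refine ⟨v, fun h => hne (Subtype.ext h), fun a => ?_⟩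
  rw [LieModule.mem_maxTrivSubmodule] at hv
  exact hv ⟨T a, ⟨a, rfl⟩⟩

/-- If the left action of every element of a finite-dimensional left Leibniz
algebra on a nonzero finite-dimensional bimodule is nilpotent, then there is a
nonzero vector annihilated by both the left and the right action. -/
theorem exists_annihilated_vector
    (K : Type*) [Field K]
    (L : Type*) [AddCommGroup L] [Module K L] [FiniteDimensional K L]
    (V : Type*) [AddCommGroup V] [Module K V] [FiniteDimensional K V]
    (mul : L →ₗ[K] L →ₗ[K] L)
    (leib : ∀ a b c : L, mul a (mul b c) = mul (mul a b) c + mul b (mul a c))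
    (T S : L →ₗ[K] V →ₗ[K] V)
    (M1 : ∀ (a b : L) (v : V), T a (T b v) = T (mul a b) v + T b (T a v))
    (M2 : ∀ (a b : L) (v : V), T a (S b v) = S b (T a v) + S (mul a b) v)
    (M3 : ∀ (a b : L) (v : V), S (mul a b) v = S b (S a v) + T a (S b v))
    (hV : ∃ v : V, v ≠ 0)
    (hT : ∀ a : L, IsNilpotent (T a : Module.End K V)) :
    ∃ v : V, v ≠ 0 ∧ ∀ a : L, T a v = 0 ∧ S a v = 0 := by
  by_cases h : ∀ a v, S a v + T a v = 0
  · obtain ⟨v0, hv0⟩ := hV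
    have : Nontrivial V := ⟨v0, 0, hv0⟩
    obtain ⟨v, hv, hv'⟩ := engel_aux K L V mul T M1 hT
    refine ⟨v, hv, fun a => ⟨hv' a, ?_⟩⟩
    simpa [hv' a] using h a v
  · push Not at h
    obtain ⟨a0, v0, h0⟩ := h
    let W : Submodule K V := ⨅ b, LinearMap.ker (S b)
    have hW : ∀ w, w ∈ W ↔ ∀ b, S b w = 0 := by
      intro w
      simp [W, Submodule.mem_iInf]
    have hw0 : S a0 v0 + T a0 v0 ∈ W := by
      rw [hW]
      intro b
      have h2 := M2 a0 b v0
      have h3 := M3 a0 b v0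
      rw [h2, ← add_assoc, right_eq_add] at h3
      rw [map_add]
      exact h3
    have hinv : ∀ a, ∀ w ∈ W, T a w ∈ W := by
      intro a w hw
      rw [hW] at hw ⊢
      intro b
      have h2 := M2 a b w
      simpa [hw] using h2.symm
    have : Nontrivial W := ⟨⟨_, hw0⟩, 0, fun h => h0 (congrArg Subtype.val h)⟩
    let T' : L →ₗ[K] Module.End K W :=
      { toFun := fun a => (T a).restrict (hinv a)
        map_add' := by intro a b; ext w; simp
        map_smul' := by intro a b; ext w; simp }
    obtain ⟨v, hv, hv'⟩ := engel_aux K L W mul T'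
      (by intro a b v; apply Subtype.ext; simpa [T'] using M1 a b v)
      (fun a => Module.End.isNilpotent.restrict (hinv a) (hT a))
    refine ⟨v, fun h => hv (Subtype.ext h), fun a => ⟨?_, (hW v).1 v.2 a⟩⟩
    exact congrArg Subtype.val (hv' a)
end

section
/- Let L be a finite-dimensional left Leibniz algebra over a field K and let V be a finite-dimensional irreducible L-bimodule. Then every square of L acts trivially on V: for all x ∈ L and v ∈ V, (x·x)·v = 0 and v·(x·x) = 0. (Equivalently, the quotient of L by the kernel of the representation on V is a Lie algebra.) -/
/-- On a finite-dimensional irreducible bimodule over a finite-dimensional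
left Leibniz algebra, every square of the algebra acts trivially. -/
theorem squares_act_trivially_on_irreducible
    (K : Type*) [Field K]
    (L : Type*) [AddCommGroup L] [Module K L] [FiniteDimensional K L]
    (V : Type*) [AddCommGroup V] [Module K V] [FiniteDimensional K V]
    (mul : L →ₗ[K] L →ₗ[K] L)
    (leib : ∀ a b c : L, mul a (mul b c) = mul (mul a b) c + mul b (mul a c))
    (T S : L →ₗ[K] V →ₗ[K] V)
    (M1 : ∀ (a b : L) (v : V), T a (T b v) = T (mul a b) v + T b (T a v))
    (M2 : ∀ (a b : L) (v : V), T a (S b v) = S b (T a v) + S (mul a b) v)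
    (M3 : ∀ (a b : L) (v : V), S (mul a b) v = S b (S a v) + T a (S b v))
    (hV : ∃ v : V, v ≠ 0)
    (hirr : ∀ U : Submodule K V,
      (∀ (a : L), ∀ u ∈ U, T a u ∈ U ∧ S a u ∈ U) → U = ⊥ ∨ U = ⊤) :
    ∀ (x : L) (v : V), T (mul x x) v = 0 ∧ S (mul x x) v = 0 := by
  intro x v
  have hT : T (mul x x) v = 0 := by
    have h := M1 x x v
    simpa using h
  refine ⟨hT, ?_⟩
  have key : ∀ (a b : L) (w : V), S b (S a w + T a w) = 0 := by
    intro a b w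
    have h2 := M2 a b w
    have h3 := M3 a b w
    rw [h2] at h3
    have h4 : S (mul a b) w + (S b (S a w) + S b (T a w)) = S (mul a b) w + 0 := by
      rw [add_zero]
      conv_rhs => rw [h3]
      abel
    rw [map_add]
    exact add_left_cancel h4
  let W : Submodule K V := ⨅ b : L, LinearMap.ker (S b)
  have hW : ∀ w, w ∈ W ↔ ∀ b, S b w = 0 := by
    intro w
    simp [W, Submodule.mem_iInf]
  rcases hirr W (by
    intro a u hu
    rw [hW] at hu
    refine ⟨(hW _).2 fun b => ?_, (hW _).2 fun b => ?_⟩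
    · have h := M2 a b u
      rw [hu b, hu (mul a b)] at h
      simpa using h.symm
    · rw [hu a, map_zero]) with h | h
  · have h1 : S (mul x x) v + T (mul x x) v ∈ W := (hW _).2 fun b => key _ b v
    rw [h, Submodule.mem_bot, hT, add_zero] at h1
    exact h1
  · have h1 : v ∈ W := by rw [h]; trivial
    exact (hW v).1 h1 _
end

section
/- Let L be a finite-dimensional left Leibniz algebra over a field K and let V be a finite-dimensional irreducible L-bimodule. Then either the right action of L on V is zero (v·x = 0 for all v ∈ V and x ∈ L), or the right action is the negative of the left action (v·x = −(x·v) for all v ∈ V and x ∈ L). -/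
/-- On a finite-dimensional irreducible bimodule over a finite-dimensional
left Leibniz algebra, the right action is either zero or the negative of the
left action. -/
theorem irreducible_bimodule_symmetric_or_antisymmetric
    (K : Type*) [Field K]
    (L : Type*) [AddCommGroup L] [Module K L] [FiniteDimensional K L]
    (V : Type*) [AddCommGroup V] [Module K V] [FiniteDimensional K V]
    (mul : L →ₗ[K] L →ₗ[K] L)
    (leib : ∀ a b c : L, mul a (mul b c) = mul (mul a b) c + mul b (mul a c))
    (T S : L →ₗ[K] V →ₗ[K] V)
    (M1 : ∀ (a b : L) (v : V), T a (T b v) = T (mul a b) v + T b (T a v))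
    (M2 : ∀ (a b : L) (v : V), T a (S b v) = S b (T a v) + S (mul a b) v)
    (M3 : ∀ (a b : L) (v : V), S (mul a b) v = S b (S a v) + T a (S b v))
    (hV : ∃ v : V, v ≠ 0)
    (hirr : ∀ U : Submodule K V,
      (∀ (a : L), ∀ u ∈ U, T a u ∈ U ∧ S a u ∈ U) → U = ⊥ ∨ U = ⊤) :
    (∀ (v : V) (x : L), S x v = 0) ∨ (∀ (v : V) (x : L), S x v = -(T x v)) := by
  -- The common kernel of the right action is a sub-bimodule containing every `S a v + T a v`.
  have key : ∀ (a b : L) (v : V), S b (S a v + T a v) = 0 := by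
    intro a b v
    have h2 := M2 a b v
    have h3 := M3 a b v
    rw [h2] at h3
    rw [map_add]
    have h4 : S (mul a b) v = (S b (S a v) + S b (T a v)) + S (mul a b) v := by
      rw [add_assoc]; exact h3
    exact right_eq_add.mp h4
  let U : Submodule K V := ⨅ b : L, LinearMap.ker (S b)
  have hU : ∀ v : V, v ∈ U ↔ ∀ b, S b v = 0 := by
    intro v; simp [U, Submodule.mem_iInf]
  have hinv : ∀ (a : L), ∀ u ∈ U, T a u ∈ U ∧ S a u ∈ U := by
    intro a u hu
    rw [hU] at hu
    refine ⟨(hU _).2 fun b => ?_, (hU _).2 fun b => ?_⟩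
    · have h2 := M2 a b u
      rw [hu b, hu (mul a b), map_zero, add_zero] at h2
      exact h2.symm
    · rw [hu a, map_zero]
  rcases hirr U hinv with h | h
  · right
    intro v x
    have hm : S x v + T x v ∈ U := (hU _).2 fun b => key x b v
    rw [h, Submodule.mem_bot] at hm
    exact eq_neg_of_add_eq_zero_left hm
  · left
    intro v x
    have hm : v ∈ U := by rw [h]; exact Submodule.mem_top
    exact (hU v).1 hm x
end

section
/- Let L be a finite-dimensional left Leibniz algebra over a field K and let V be a finite-dimensional irreducible L-bimodule on which the representation is faithful (i.e. the only a ∈ L with a·v = 0 and v·a = 0 for all v ∈ V is a = 0). Then L is a Lie algebra: x·x = 0 for all x ∈ L. -/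
/-- A finite-dimensional left Leibniz algebra with a faithful
finite-dimensional irreducible bimodule is a Lie algebra: all squares
vanish. -/
theorem faithful_irreducible_implies_lie
    (K : Type*) [Field K]
    (L : Type*) [AddCommGroup L] [Module K L] [FiniteDimensional K L]
    (V : Type*) [AddCommGroup V] [Module K V] [FiniteDimensional K V]
    (mul : L →ₗ[K] L →ₗ[K] L)
    (leib : ∀ a b c : L, mul a (mul b c) = mul (mul a b) c + mul b (mul a c))
    (T S : L →ₗ[K] V →ₗ[K] V)
    (M1 : ∀ (a b : L) (v : V), T a (T b v) = T (mul a b) v + T b (T a v))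
    (M2 : ∀ (a b : L) (v : V), T a (S b v) = S b (T a v) + S (mul a b) v)
    (M3 : ∀ (a b : L) (v : V), S (mul a b) v = S b (S a v) + T a (S b v))
    (hV : ∃ v : V, v ≠ 0)
    (hirr : ∀ U : Submodule K V,
      (∀ (a : L), ∀ u ∈ U, T a u ∈ U ∧ S a u ∈ U) → U = ⊥ ∨ U = ⊤)
    (hfaith : ∀ a : L, (∀ v : V, T a v = 0 ∧ S a v = 0) → a = 0) :
    ∀ x : L, mul x x = 0 := by
  have key : ∀ (a b : L) (v : V), S b (S a v + T a v) = 0 := by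
    intro a b v
    have h2 := M2 a b v
    have h3 := M3 a b v
    rw [h2, ← add_assoc] at h3
    rw [map_add]
    exact left_eq_add.mp (by rw [add_comm]; exact h3)
  have hT : ∀ (x : L) (v : V), T (mul x x) v = 0 := by
    intro x v
    simpa using M1 x x v
  let U : Submodule K V := ⨅ b : L, LinearMap.ker (S b)
  have hU : ∀ u, u ∈ U ↔ ∀ b, S b u = 0 := by
    intro u
    simp [U, Submodule.mem_iInf]
  have hinv := hirr U (by
    intro a u hu
    rw [hU] at hu
    refine ⟨(hU _).2 fun b => ?_, (hU _).2 fun b => ?_⟩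
    · have h := M2 a b u
      rw [hu b, hu (mul a b), map_zero, add_zero] at h
      exact h.symm
    · rw [hu a, map_zero])
  intro x
  apply hfaith
  intro v
  refine ⟨hT x v, ?_⟩
  rcases hinv with h | h
  · have hm : S (mul x x) v + T (mul x x) v ∈ U := (hU _).2 fun b => key _ b v
    rw [h, Submodule.mem_bot, hT, add_zero] at hm
    exact hm
  · have hm : v ∈ U := by rw [h]; trivial
    exact (hU v).1 hm _
end
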